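/- arXiv:2305.05123 — 3 statements merged into one kernel-verified Lean document; each statement's English description precedes it below -/
import Mathlib

section
/- Let H be a finite-dimensional complex Hilbert space with dim H ≥ 2. Every map φ: P(H) → P(H) satisfying ‖φ(P) − φ(Q)‖ ≥ ‖P − Q‖ for all P, Q ∈ P(H) is a Wigner symmetry. -/
open scoped InnerProductSpace ComplexConjugate

variable {H : Type*} [NormedAddCommGroup H] [InnerProductSpace ℂ H] [CompleteSpace H]

/-- The rank-one (orthogonal) projection onto the span of a unit vector `v`,
i.e. `x ↦ ⟪v, x⟫ • v`. -/
noncomputable def rankOneProj (v : H) : H →L[ℂ] H :=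
  (innerSL ℂ v).smulRight v

/-- A rank-one projection: a self-adjoint idempotent bounded operator with
one-dimensional range. -/
def IsRankOneProjection (P : H →L[ℂ] H) : Prop :=
  IsSelfAdjoint P ∧ P ∘L P = P ∧ Module.finrank ℂ (LinearMap.range (P : H →ₗ[ℂ] H)) = 1

/-- `φ` is a Wigner symmetry: there is a unitary or antiunitary operator `U` on `H`
(an additive, norm-preserving, surjective map that is `ℂ`-linear or conjugate-linear)
such that `φ P = U P U*` for every rank-one projection `P`; equivalently, `φ` sends the
projection onto `ℂv` to the projection onto `ℂ(Uv)` for every unit vector `v`. -/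
def IsWignerSymmetry
    (φ : {P : H →L[ℂ] H // IsRankOneProjection P} → {P : H →L[ℂ] H // IsRankOneProjection P}) :
    Prop :=
  ∃ U : H → H,
    (∀ x y, U (x + y) = U x + U y) ∧
    (∀ x, ‖U x‖ = ‖x‖) ∧
    Function.Surjective U ∧
    ((∀ (c : ℂ) (x : H), U (c • x) = c • U x) ∨
      (∀ (c : ℂ) (x : H), U (c • x) = (starRingEnd ℂ) c • U x)) ∧
    (∀ (v : H), ‖v‖ = 1 → ∀ P : {P : H →L[ℂ] H // IsRankOneProjection P},
      P.1 = rankOneProj v → (φ P).1 = rankOneProj (U v))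

/-- A noncontractive self-map of a totally bounded space is an isometry. -/
theorem isometry_of_noncontractive {X : Type*} [PseudoMetricSpace X]
    (hX : TotallyBounded (Set.univ : Set X)) {f : X → X}
    (hf : ∀ x y, dist x y ≤ dist (f x) (f y)) : Isometry f := by
  have hiter : ∀ n x y, dist x y ≤ dist (f^[n] x) (f^[n] y) := by
    intro n
    induction n with
    | zero => simp
    | succ n ih =>
      intro x y
      rw [Function.iterate_succ_apply', Function.iterate_succ_apply']
      exact (ih x y).trans (hf _ _)
  refine Isometry.of_dist_eq fun x y => le_antisymm ?_ (hf x y)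
  refine le_of_forall_pos_le_add fun ε hε => ?_
  obtain ⟨t, ht, hcover⟩ := Metric.totallyBounded_iff.1 hX (ε / 4) (by positivity)
  have hnear : ∀ z : X, ∃ c : t, dist z c < ε / 4 := by
    intro z
    obtain ⟨c, hc, hz⟩ := Set.mem_iUnion₂.1 (hcover (Set.mem_univ z))
    exact ⟨⟨c, hc⟩, hz⟩
  choose c hc using hnear
  have : Finite t := ht
  obtain ⟨m, n, hmn, heq⟩ :=
    Finite.exists_ne_map_eq_of_infinite fun n : ℕ => (c (f^[n] x), c (f^[n] y))
  wlog hlt : m < n generalizing m n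
  · exact this n m hmn.symm heq.symm (lt_of_le_of_ne (not_lt.1 hlt) hmn.symm)
  obtain ⟨k, rfl⟩ : ∃ k, n = m + (k + 1) := ⟨n - m - 1, by omega⟩
  simp only [Prod.mk.injEq] at heq
  have hreturn : ∀ z, c (f^[m] z) = c (f^[m + (k + 1)] z) → dist z (f^[k + 1] z) < ε / 2 := by
    intro z hz
    have h₁ := hiter m z (f^[k + 1] z)
    rw [← Function.iterate_add_apply] at h₁
    have h₂ := hc (f^[m] z)
    have h₃ := hc (f^[m + (k + 1)] z)
    rw [← hz] at h₃
    have h₄ := dist_triangle_right (f^[m] z) (f^[m + (k + 1)] z) (c (f^[m] z) : X)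
    linarith
  have hx := hreturn x heq.1
  have hy := hreturn y heq.2
  have h := hiter k (f x) (f y)
  rw [← Function.iterate_succ_apply, ← Function.iterate_succ_apply] at h
  have h₁ := dist_triangle4 (f^[k + 1] x) x y (f^[k + 1] y)
  rw [dist_comm (f^[k + 1] x) x] at h₁
  linarith

section RealInner

variable {E F : Type*} [NormedAddCommGroup E] [InnerProductSpace ℂ E]
  [NormedAddCommGroup F] [InnerProductSpace ℂ F] {g : E → F}

theorem eq_zero_of_re_inner_self {x : F} (h : (⟪x, x⟫_ℂ).re = 0) : x = 0 := by
  have h₁ : (⟪x, x⟫_ℂ).re = ‖x‖ ^ 2 := inner_self_eq_norm_sq (𝕜 := ℂ) x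
  rw [h₁] at h
  exact norm_eq_zero.1 (pow_eq_zero_iff two_ne_zero |>.1 h)

theorem map_add_of_re_inner_eq
    (hre : ∀ u v, (⟪g u, g v⟫_ℂ).re = (⟪u, v⟫_ℂ).re) (u v : E) :
    g (u + v) = g u + g v := by
  rw [← sub_eq_zero]
  apply eq_zero_of_re_inner_self
  simp only [inner_sub_left, inner_sub_right, inner_add_left, inner_add_right, Complex.sub_re,
    Complex.add_re, hre]
  ring

theorem map_real_smul_of_re_inner_eq
    (hre : ∀ u v, (⟪g u, g v⟫_ℂ).re = (⟪u, v⟫_ℂ).re) (r : ℝ) (u : E) :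
    g ((r : ℂ) • u) = (r : ℂ) • g u := by
  rw [← sub_eq_zero]
  apply eq_zero_of_re_inner_self
  simp only [inner_sub_left, inner_sub_right, inner_smul_left, inner_smul_right, Complex.sub_re,
    Complex.conj_ofReal, Complex.re_ofReal_mul, hre]
  ring

theorem map_I_smul_eq_or
    (hre : ∀ u v, (⟪g u, g v⟫_ℂ).re = (⟪u, v⟫_ℂ).re)
    (habs : ∀ u v, ‖⟪g u, g v⟫_ℂ‖ = ‖⟪u, v⟫_ℂ‖) (u : E) :
    g (Complex.I • u) = Complex.I • g u ∨ g (Complex.I • u) = -(Complex.I • g u) := by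
  have hself : ⟪u, u⟫_ℂ = ((‖u‖ ^ 2 : ℝ) : ℂ) := by
    rw [inner_self_eq_norm_sq_to_K]; simp
  have h₀ : (⟪g u, g (Complex.I • u)⟫_ℂ).re = 0 := by
    rw [hre, inner_smul_right, hself, Complex.I_mul_re, Complex.ofReal_im, neg_zero]
  have h₁ : (⟪g u, g (Complex.I • u)⟫_ℂ).im ^ 2 = (‖u‖ ^ 2) ^ 2 := by
    have h := congrArg (· ^ 2) (habs u (Complex.I • u))
    simp only [inner_smul_right, norm_mul, Complex.norm_I, one_mul, hself, Complex.norm_real,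
      Complex.sq_norm, Complex.normSq_apply, h₀] at h
    simp at h
    nlinarith [h]
  have hflip : (⟪g (Complex.I • u), g u⟫_ℂ).im = -(⟪g u, g (Complex.I • u)⟫_ℂ).im := by
    rw [← inner_conj_symm, Complex.conj_im]
  have hn₁ : (⟪g (Complex.I • u), g (Complex.I • u)⟫_ℂ).re = ‖u‖ ^ 2 := by
    rw [hre, inner_smul_left, inner_smul_right, hself, ← mul_assoc]
    rw [Complex.conj_I, neg_mul, Complex.I_mul_I, neg_neg, one_mul, Complex.ofReal_re]
  have hn₂ : (⟪g u, g u⟫_ℂ).re = ‖u‖ ^ 2 := by rw [hre, hself, Complex.ofReal_re]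
  rcases sq_eq_sq_iff_eq_or_eq_neg.1 h₁ with h | h
  · left
    rw [← sub_eq_zero]
    apply eq_zero_of_re_inner_self
    simp only [inner_sub_left, inner_sub_right, inner_smul_left, inner_smul_right, Complex.sub_re,
      Complex.sub_im, Complex.mul_re, Complex.mul_im, Complex.conj_I, Complex.neg_re, Complex.neg_im,
      Complex.I_re, Complex.I_im, hflip, hn₁, hn₂, h]
    ring
  · right
    rw [← sub_eq_zero, sub_neg_eq_add]
    apply eq_zero_of_re_inner_self
    simp only [inner_add_left, inner_add_right, inner_smul_left, inner_smul_right, Complex.add_re,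
      Complex.add_im, Complex.mul_re, Complex.mul_im, Complex.conj_I, Complex.neg_re, Complex.neg_im,
      Complex.I_re, Complex.I_im, hflip, hn₁, hn₂, h]
    ring

/-- A map preserving the real parts and the absolute values of inner products is
`ℂ`-linear or conjugate-linear. -/
theorem map_smul_or_map_conj_smul
    (hre : ∀ u v, (⟪g u, g v⟫_ℂ).re = (⟪u, v⟫_ℂ).re)
    (habs : ∀ u v, ‖⟪g u, g v⟫_ℂ‖ = ‖⟪u, v⟫_ℂ‖) :
    (∀ (c : ℂ) (u : E), g (c • u) = c • g u) ∨
      (∀ (c : ℂ) (u : E), g (c • u) = conj c • g u) := by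
  have hadd := map_add_of_re_inner_eq hre
  have hreal := map_real_smul_of_re_inner_eq hre
  have hI := map_I_smul_eq_or hre habs
  have hsplit : ∀ (c : ℂ) (u : E),
      g (c • u) = (c.re : ℂ) • g u + (c.im : ℂ) • g (Complex.I • u) := by
    intro c u
    conv_lhs => rw [← Complex.re_add_im c, add_smul, mul_smul, hadd, hreal, hreal]
  by_cases hlin : ∀ u, g (Complex.I • u) = Complex.I • g u
  · left
    intro c u
    rw [hsplit, hlin, smul_smul, ← add_smul, Complex.re_add_im]
  · right
    push Not at hlin
    obtain ⟨u, hu⟩ := hlin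
    have hu' := (hI u).resolve_left hu
    have hanti : ∀ v, g (Complex.I • v) = -(Complex.I • g v) := by
      intro v
      by_contra hv
      have hv' := (hI v).resolve_right hv
      have hsum : g (Complex.I • (u + v)) = -(Complex.I • g u) + Complex.I • g v := by
        rw [smul_add, hadd, hu', hv']
      rcases hI (u + v) with h | h <;> rw [hsum, hadd, smul_add] at h
      · have h' : -(Complex.I • g u) = Complex.I • g u := add_right_cancel h
        exact hu (hu'.trans h')
      · rw [neg_add] at h
        exact hv (hv'.trans (add_left_cancel h))
    intro c u
    rw [hsplit, hanti, smul_neg, smul_smul, ← neg_smul, ← add_smul]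
    congr 1
    apply Complex.ext <;> simp

end RealInner

section Wigner

variable {E F : Type*} [NormedAddCommGroup E] [InnerProductSpace ℂ E]
  [NormedAddCommGroup F] [InnerProductSpace ℂ F]

theorem exists_phase_smul_eq {x y : F} (hn : ‖y‖ = ‖x‖) (h : ‖⟪x, y⟫_ℂ‖ = ‖x‖ ^ 2) :
    ∃ c : ℂ, ‖c‖ = 1 ∧ y = c • x := by
  have h' : ‖⟪x, y⟫_ℂ‖ = ‖x‖ * ‖y‖ := by rw [h, hn, sq]
  rcases ((norm_inner_eq_norm_tfae ℂ x y).out 0 2).1 h' with rfl | ⟨r, rfl⟩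
  · exact ⟨1, by simp, by simpa using hn⟩
  · by_cases hx : x = 0
    · exact ⟨1, by simp, by simp [hx]⟩
    · refine ⟨r, ?_, rfl⟩
      rw [norm_smul] at hn
      exact mul_right_cancel₀ (norm_ne_zero_iff.2 hx) (by rw [hn, one_mul])

theorem norm_map_of_norm_inner_eq {T : E → F}
    (hT : ∀ u v, ‖⟪T u, T v⟫_ℂ‖ = ‖⟪u, v⟫_ℂ‖) (x : E) : ‖T x‖ = ‖x‖ := by
  have h := hT x x
  rw [inner_self_eq_norm_sq_to_K, inner_self_eq_norm_sq_to_K] at h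
  simpa using h

/-- On the orthogonal complement of a unit vector `e`, a map preserving the absolute values
of inner products agrees up to phases with a map `g` into the orthogonal complement of `T e`
that also preserves real parts, and `T e + g u` agrees up to a phase with `T (e + u)`. -/
theorem exists_re_inner_preserving {T : E → F}
    (hT : ∀ u v, ‖⟪T u, T v⟫_ℂ‖ = ‖⟪u, v⟫_ℂ‖) {e : E} (he : ‖e‖ = 1) :
    ∃ g : (ℂ ∙ e)ᗮ → F,
      (∀ u v, (⟪g u, g v⟫_ℂ).re = (⟪u, v⟫_ℂ).re) ∧
      (∀ u v, ‖⟪g u, g v⟫_ℂ‖ = ‖⟪u, v⟫_ℂ‖) ∧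
      (∀ u, ∃ c : ℂ, ‖c‖ = 1 ∧ g u = c • T u) ∧
      (∀ u, ∃ c : ℂ, ‖c‖ = 1 ∧ T e + g u = c • T (e + u)) := by
  have hself : ∀ x : F, ⟪x, x⟫_ℂ = ((‖x‖ ^ 2 : ℝ) : ℂ) := fun x => by
    rw [inner_self_eq_norm_sq_to_K]; simp
  have hself' : ∀ x : E, ⟪x, x⟫_ℂ = ((‖x‖ ^ 2 : ℝ) : ℂ) := fun x => by
    rw [inner_self_eq_norm_sq_to_K]; simp
  have hTn := norm_map_of_norm_inner_eq hT
  have hff : ⟪T e, T e⟫_ℂ = 1 := by rw [hself, hTn, he]; simp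
  have hee : ⟪e, e⟫_ℂ = 1 := by rw [hself', he]; simp
  have heu : ∀ u : (ℂ ∙ e)ᗮ, ⟪e, (u : E)⟫_ℂ = 0 := fun u =>
    Submodule.mem_orthogonal_singleton_iff_inner_right.1 u.2
  have hue : ∀ u : (ℂ ∙ e)ᗮ, ⟪(u : E), e⟫_ℂ = 0 := fun u =>
    Submodule.mem_orthogonal_singleton_iff_inner_left.1 u.2
  let a : (ℂ ∙ e)ᗮ → ℂ := fun u => ⟪T e, T (e + u)⟫_ℂ
  have ha : ∀ u, ‖a u‖ = 1 := fun u => by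
    simp only [a, hT, inner_add_right, hee, heu, add_zero, norm_one]
  let g : (ℂ ∙ e)ᗮ → F := fun u => conj (a u) • T (e + u) - T e
  have hg : ∀ u, T e + g u = conj (a u) • T (e + u) := fun u => add_sub_cancel _ _
  have hfg : ∀ u, ⟪T e, g u⟫_ℂ = 0 := by
    intro u
    change ⟪T e, conj (a u) • T (e + u) - T e⟫_ℂ = 0
    rw [inner_sub_right, inner_smul_right, hff, Complex.conj_mul', ha]
    simp
  have hgf : ∀ u, ⟪g u, T e⟫_ℂ = 0 := fun u => inner_eq_zero_symm.1 (hfg u)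
  have hone : ∀ u v, ‖1 + ⟪g u, g v⟫_ℂ‖ = ‖1 + ⟪u, v⟫_ℂ‖ := by
    intro u v
    have h₁ : ⟪T e + g u, T e + g v⟫_ℂ = 1 + ⟪g u, g v⟫_ℂ := by
      simp only [inner_add_left, inner_add_right, hff, hfg, hgf, add_zero, zero_add]
    have h₂ : ⟪e + (u : E), e + (v : E)⟫_ℂ = 1 + ⟪u, v⟫_ℂ := by
      simp only [inner_add_left, inner_add_right, hee, heu, hue, add_zero, zero_add,
        Submodule.coe_inner]
    rw [← h₁, ← h₂, hg, hg, inner_smul_left, inner_smul_right, norm_mul, norm_mul, hT]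
    simp [ha]
  have hgn : ∀ u, ‖g u‖ = ‖u‖ := by
    intro u
    have h := hone u u
    rw [Submodule.coe_inner, hself, hself', ← Complex.ofReal_one, ← Complex.ofReal_add,
      ← Complex.ofReal_add, Complex.norm_of_nonneg (by positivity),
      Complex.norm_of_nonneg (by positivity)] at h
    exact (sq_eq_sq₀ (norm_nonneg _) (norm_nonneg _)).1 (add_left_cancel h)
  have hphase : ∀ u : (ℂ ∙ e)ᗮ, ∃ c : ℂ, ‖c‖ = 1 ∧ g u = c • T u := by
    intro u
    refine exists_phase_smul_eq ((hgn u).trans (hTn u).symm) ?_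
    have h₀ : ⟪T u, T e⟫_ℂ = 0 := by rw [← norm_eq_zero, hT, hue, norm_zero]
    change ‖⟪T u, conj (a u) • T (e + u) - T e⟫_ℂ‖ = _
    rw [inner_sub_right, h₀, sub_zero, inner_smul_right, norm_mul, RCLike.norm_conj, ha, hT,
      inner_add_right, hue, hself', hTn]
    simp
  have habs : ∀ u v, ‖⟪g u, g v⟫_ℂ‖ = ‖⟪u, v⟫_ℂ‖ := by
    intro u v
    obtain ⟨c, hc, hcu⟩ := hphase u
    obtain ⟨d, hd, hdv⟩ := hphase v
    rw [hcu, hdv, inner_smul_left, inner_smul_right, norm_mul, norm_mul, RCLike.norm_conj, hc, hd,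
      hT, one_mul, one_mul, Submodule.coe_inner]
  refine ⟨g, fun u v => ?_, habs, hphase, fun u => ⟨_, by rw [RCLike.norm_conj, ha], hg u⟩⟩
  have hsq : ∀ z : ℂ, ‖1 + z‖ ^ 2 = 1 + 2 * z.re + ‖z‖ ^ 2 := by
    intro z
    rw [Complex.sq_norm, Complex.sq_norm, Complex.normSq_apply, Complex.normSq_apply]
    simp
    ring
  have h := hsq ⟪g u, g v⟫_ℂ
  rw [hone, habs, hsq] at h
  linarith

/-- **Wigner's theorem**: a map preserving the absolute values of inner products agrees up to
phases with a linear or conjugate-linear isometry. -/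
theorem exists_semilinear_isometry {T : E → F}
    (hT : ∀ u v, ‖⟪T u, T v⟫_ℂ‖ = ‖⟪u, v⟫_ℂ‖) {e : E} (he : ‖e‖ = 1) :
    ∃ U : E → F, (∀ x y, U (x + y) = U x + U y) ∧
      ((∀ (c : ℂ) (x : E), U (c • x) = c • U x) ∨
        (∀ (c : ℂ) (x : E), U (c • x) = conj c • U x)) ∧
      ∀ x, ∃ c : ℂ, ‖c‖ = 1 ∧ U x = c • T x := by
  obtain ⟨g, hre, habs, hphase, hphase'⟩ := exists_re_inner_preserving hT he
  have hadd := map_add_of_re_inner_eq hre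
  have hTn := norm_map_of_norm_inner_eq hT
  obtain ⟨σ, hσ, hσn, hσg⟩ : ∃ σ : ℂ →+* ℂ, ((∀ c, σ c = c) ∨ ∀ c, σ c = conj c) ∧
      (∀ c, ‖σ c‖ = ‖c‖) ∧ ∀ (c : ℂ) u, g (c • u) = σ c • g u := by
    rcases map_smul_or_map_conj_smul hre habs with h | h
    · exact ⟨RingHom.id ℂ, Or.inl fun _ => rfl, fun _ => rfl, h⟩
    · exact ⟨starRingEnd ℂ, Or.inr fun _ => rfl, RCLike.norm_conj, h⟩
  let p := (ℂ ∙ e)ᗮ.orthogonalProjectionOnto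
  have hp : ∀ x, x = ⟪e, x⟫_ℂ • e + (p x : E) := by
    intro x
    have h := Submodule.starProjection_add_starProjection_orthogonal (K := ℂ ∙ e) x
    rw [Submodule.starProjection_unit_singleton ℂ he] at h
    exact h.symm
  have hU : ∀ (c : ℂ) x, σ ⟪e, c • x⟫_ℂ • T e + g (p (c • x)) =
      σ c • (σ ⟪e, x⟫_ℂ • T e + g (p x)) := by
    intro c x
    rw [map_smul, hσg, inner_smul_right, map_mul, smul_add, mul_smul]
  refine ⟨fun x => σ ⟪e, x⟫_ℂ • T e + g (p x), fun x y => ?_, ?_, fun x => ?_⟩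
  · simp only [inner_add_right, map_add, hadd, add_smul]
    abel
  · rcases hσ with h | h
    · exact Or.inl fun c x => by simpa only [h] using hU c x
    · exact Or.inr fun c x => by simpa only [h] using hU c x
  · beta_reduce
    by_cases hc : ⟪e, x⟫_ℂ = 0
    · have hx := hp x
      rw [hc, zero_smul, zero_add] at hx
      rw [hc, map_zero, zero_smul, zero_add]
      obtain ⟨c, h₁, h₂⟩ := hphase (p x)
      exact ⟨c, h₁, by rw [h₂, ← hx]⟩
    · obtain ⟨d, hd, hdx⟩ := hphase' ((⟪e, x⟫_ℂ)⁻¹ • p x)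
      set c := ⟪e, x⟫_ℂ
      set w := e + ((c⁻¹ • p x : (ℂ ∙ e)ᗮ) : E)
      have hx : x = c • w := by
        rw [smul_add, Submodule.coe_smul, smul_inv_smul₀ hc]
        exact hp x
      have hUx : σ c • T e + g (p x) = (σ c * d) • T w := by
        rw [mul_smul, ← hdx, smul_add, ← hσg, smul_inv_smul₀ hc]
      rw [hUx]
      have hcd : ‖σ c * d‖ = ‖c‖ := by rw [norm_mul, hσn, hd, mul_one]
      apply exists_phase_smul_eq
      · rw [norm_smul, hcd, hTn, hTn, hx, norm_smul]
      · rw [inner_smul_right, norm_mul, hcd, hT, ← norm_mul, ← inner_smul_right, ← hx, hTn,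
          inner_self_eq_norm_sq_to_K]
        simp

end Wigner

section Projections

variable {E : Type*} [NormedAddCommGroup E] [InnerProductSpace ℂ E]

theorem rankOneProj_apply (v x : E) : rankOneProj v x = ⟪v, x⟫_ℂ • v := rfl

theorem rankOneProj_phase_smul {c : ℂ} (hc : ‖c‖ = 1) (v : E) :
    rankOneProj (c • v) = rankOneProj v := by
  ext x
  rw [rankOneProj_apply, rankOneProj_apply, inner_smul_left, smul_smul, mul_right_comm,
    Complex.conj_mul', hc]
  simp

theorem isRankOneProjection_rankOneProj {v : H} (hv : ‖v‖ = 1) :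
    IsRankOneProjection (rankOneProj v) := by
  refine ⟨?_, ?_, ?_⟩
  · rw [ContinuousLinearMap.isSelfAdjoint_iff_isSymmetric]
    intro x y
    simp only [ContinuousLinearMap.coe_coe, rankOneProj_apply, inner_smul_left, inner_smul_right,
      inner_conj_symm]
    ring
  · ext x
    simp [rankOneProj_apply, hv]
  · rw [finrank_eq_one_iff']
    refine ⟨⟨v, v, by simp [rankOneProj_apply, hv]⟩, ?_, ?_⟩
    · intro h
      have : v = 0 := congrArg Subtype.val h
      simp [this] at hv
    · rintro ⟨_, x, rfl⟩
      exact ⟨⟪v, x⟫_ℂ, rfl⟩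

theorem IsRankOneProjection.exists_eq_rankOneProj {P : H →L[ℂ] H} (hP : IsRankOneProjection P) :
    ∃ v : H, ‖v‖ = 1 ∧ P = rankOneProj v := by
  obtain ⟨hsa, hidem, hrank⟩ := hP
  obtain ⟨⟨w, z, hz⟩, hw, hspan⟩ := finrank_eq_one_iff'.1 hrank
  have hw₀ : w ≠ 0 := fun h => hw (Subtype.ext h)
  have hPw : P w = w := by
    have := congrArg (fun A : H →L[ℂ] H => A z) hidem
    rw [← hz]
    exact this
  have hn : ((‖w‖ : ℝ) : ℂ) ≠ 0 := by simpa using hw₀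
  have hv : ‖((‖w‖ : ℝ) : ℂ)⁻¹ • w‖ = 1 := norm_smul_inv_norm hw₀
  refine ⟨((‖w‖ : ℝ) : ℂ)⁻¹ • w, hv, ?_⟩
  set v := ((‖w‖ : ℝ) : ℂ)⁻¹ • w with hvw
  have hPv : P v = v := by rw [hvw, map_smul, hPw]
  have hvv : ⟪v, v⟫_ℂ = 1 := by rw [inner_self_eq_norm_sq_to_K, hv]; simp
  ext x
  obtain ⟨c, hc⟩ := hspan ⟨P x, x, rfl⟩
  have hc' : c • w = P x := congrArg Subtype.val hc
  have hx : P x = (c * (‖w‖ : ℝ)) • v := by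
    rw [hvw, mul_smul, smul_inv_smul₀ hn, hc']
  have hsymm : ⟪P v, x⟫_ℂ = ⟪v, P x⟫_ℂ :=
    ContinuousLinearMap.isSelfAdjoint_iff_isSymmetric.1 hsa v x
  rw [hPv, hx, inner_smul_right, hvv, mul_one] at hsymm
  rw [rankOneProj_apply, hsymm, hx]

theorem norm_rankOneProj_sub_sq {u v : H} (hu : ‖u‖ = 1) (hv : ‖v‖ = 1) :
    ‖rankOneProj u - rankOneProj v‖ ^ 2 = 1 - ‖⟪u, v⟫_ℂ‖ ^ 2 := by
  have huu : ⟪u, u⟫_ℂ = 1 := by rw [inner_self_eq_norm_sq_to_K, hu]; simp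
  have hvv : ⟪v, v⟫_ℂ = 1 := by rw [inner_self_eq_norm_sq_to_K, hv]; simp
  have huv : ⟪u, v⟫_ℂ * ⟪v, u⟫_ℂ = ((‖⟪u, v⟫_ℂ‖ ^ 2 : ℝ) : ℂ) := by
    rw [← inner_conj_symm v u, Complex.mul_conj']; simp
  have ht : 0 ≤ 1 - ‖⟪u, v⟫_ℂ‖ ^ 2 := by
    have h := norm_inner_le_norm (𝕜 := ℂ) u v
    rw [hu, hv, one_mul] at h
    nlinarith [norm_nonneg ⟪u, v⟫_ℂ]
  set t : ℝ := 1 - ‖⟪u, v⟫_ℂ‖ ^ 2 with ht_def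
  have huv' : ⟪u, v⟫_ℂ * ⟪v, u⟫_ℂ = 1 - (t : ℂ) := by rw [huv, ht_def]; push_cast; ring
  set A : H →L[ℂ] H := rankOneProj u - rankOneProj v with hA
  have hAx : ∀ x, A x = ⟪u, x⟫_ℂ • u - ⟪v, x⟫_ℂ • v := fun x => rfl
  have hAAu : A (A u) = (t : ℂ) • u := by
    simp only [hAx, inner_sub_right, inner_smul_right, huu, hvv]
    match_scalars
    · linear_combination -huv'
    · ring
  have hAAv : A (A v) = (t : ℂ) • v := by
    simp only [hAx, inner_sub_right, inner_smul_right, huu, hvv]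
    match_scalars
    · ring
    · linear_combination -huv'
  have hcube : A * A * (A * A) = (t : ℂ) • (A * A) := by
    ext x
    change A (A (A (A x))) = (t : ℂ) • A (A x)
    conv_lhs => rw [hAx x]
    rw [map_sub, map_sub, map_smul, map_smul, map_sub, map_smul, map_smul, map_smul, map_smul,
      hAAu, hAAv]
    conv_rhs => rw [hAx x]
    simp only [map_sub, map_smul, smul_sub]
    match_scalars <;> ring
  have hsa : IsSelfAdjoint A :=
    (isRankOneProjection_rankOneProj hu).1.sub (isRankOneProjection_rankOneProj hv).1
  have hnorm : ∀ B : H →L[ℂ] H, IsSelfAdjoint B → ‖B * B‖ = ‖B‖ ^ 2 := by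
    intro B hB
    have h := CStarRing.norm_star_mul_self (x := B)
    rwa [hB.star_eq, ← sq ‖B‖] at h
  have hsa₂ : IsSelfAdjoint (A * A) := by rw [← sq]; exact hsa.pow 2
  have h := congrArg norm hcube
  rw [hnorm _ hsa₂, norm_smul, hnorm _ hsa, Complex.norm_of_nonneg ht] at h
  by_cases h₀ : ‖A‖ ^ 2 = 0
  · have hA₀ : A = 0 := by simpa using h₀
    have : (t : ℂ) • u = 0 := by rw [← hAAu, hA₀]; simp
    have hu₀ : u ≠ 0 := fun h => by simp [h] at hu
    have : t = 0 := by simpa [hu₀] using this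
    rw [h₀, this]
  · rw [sq] at h
    exact mul_right_cancel₀ h₀ h

theorem totallyBounded_rankOneProjections [FiniteDimensional ℂ H] :
    TotallyBounded (Set.univ : Set {P : H →L[ℂ] H // IsRankOneProjection P}) := by
  rw [← totallyBounded_image_iff (f := Subtype.val)
    isUniformEmbedding_subtype_val.isUniformInducing]
  have : ProperSpace (H →L[ℂ] H) := FiniteDimensional.proper ℂ _
  refine (isCompact_closedBall (0 : H →L[ℂ] H) 1).totallyBounded.subset ?_
  rintro _ ⟨⟨P, hP⟩, -, rfl⟩
  rw [mem_closedBall_zero_iff]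
  obtain ⟨v, hv, rfl⟩ := hP.exists_eq_rankOneProj
  refine ContinuousLinearMap.opNorm_le_bound _ zero_le_one fun x => ?_
  rw [rankOneProj_apply, norm_smul, hv, mul_one]
  simpa [hv] using norm_inner_le_norm (𝕜 := ℂ) v x

end Projections

/-- Corollary 1.2 (1). If `H` is finite-dimensional with `dim H ≥ 2`,
then every noncontractive map on the set of rank-one projections is a Wigner symmetry. -/
theorem finiteDimensional_noncontractive_is_wigner
    [FiniteDimensional ℂ H] (hdim : 2 ≤ Module.finrank ℂ H)
    (φ : {P : H →L[ℂ] H // IsRankOneProjection P} → {P : H →L[ℂ] H // IsRankOneProjection P})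
    (hnc : ∀ P Q : {P : H →L[ℂ] H // IsRankOneProjection P},
      ‖(φ P).1 - (φ Q).1‖ ≥ ‖P.1 - Q.1‖) :
    IsWignerSymmetry φ := by
  have hiso : ∀ P Q, ‖(φ P).1 - (φ Q).1‖ = ‖P.1 - Q.1‖ := by
    have h : Isometry φ := isometry_of_noncontractive totallyBounded_rankOneProjections
      fun P Q => by
        rw [Subtype.dist_eq, Subtype.dist_eq, dist_eq_norm, dist_eq_norm]
        exact hnc P Q
    intro P Q
    simpa only [Subtype.dist_eq, dist_eq_norm] using h.dist_eq P Q
  have : Nontrivial H := Module.nontrivial_of_finrank_pos (R := ℂ) (by omega)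
  obtain ⟨e, he⟩ := exists_norm_eq H zero_le_one
  have hrep : ∀ x : H, ∃ y : H, ‖y‖ = 1 ∧
      ∀ P : {P : H →L[ℂ] H // IsRankOneProjection P},
        P.1 = rankOneProj (((‖x‖ : ℝ) : ℂ)⁻¹ • x) → (φ P).1 = rankOneProj y := by
    intro x
    by_cases h : ∃ P : {P : H →L[ℂ] H // IsRankOneProjection P},
        P.1 = rankOneProj (((‖x‖ : ℝ) : ℂ)⁻¹ • x)
    · obtain ⟨P, hP⟩ := h
      obtain ⟨y, hy, hPy⟩ := (φ P).2.exists_eq_rankOneProj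
      exact ⟨y, hy, fun Q hQ => by rw [Subtype.ext (hQ.trans hP.symm), hPy]⟩
    · exact ⟨e, he, fun P hP => absurd ⟨P, hP⟩ h⟩
  choose τ hτn hτ using hrep
  have hunit : ∀ u v : H, u ≠ 0 → v ≠ 0 →
      ‖⟪τ u, τ v⟫_ℂ‖ = ‖⟪((‖u‖ : ℝ) : ℂ)⁻¹ • u, ((‖v‖ : ℝ) : ℂ)⁻¹ • v⟫_ℂ‖ := by
    intro u v hu hv
    have hu' : ‖((‖u‖ : ℝ) : ℂ)⁻¹ • u‖ = 1 := norm_smul_inv_norm hu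
    have hv' : ‖((‖v‖ : ℝ) : ℂ)⁻¹ • v‖ = 1 := norm_smul_inv_norm hv
    have h := hiso ⟨_, isRankOneProjection_rankOneProj hu'⟩ ⟨_, isRankOneProjection_rankOneProj hv'⟩
    rw [hτ u _ rfl, hτ v _ rfl] at h
    have h' := congrArg (· ^ 2) h
    simp only [norm_rankOneProj_sub_sq (hτn u) (hτn v), norm_rankOneProj_sub_sq hu' hv'] at h'
    exact (sq_eq_sq₀ (norm_nonneg _) (norm_nonneg _)).1 (sub_right_injective h')
  have hT : ∀ u v : H, ‖⟪((‖u‖ : ℝ) : ℂ) • τ u, ((‖v‖ : ℝ) : ℂ) • τ v⟫_ℂ‖ = ‖⟪u, v⟫_ℂ‖ := by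
    intro u v
    by_cases hu : u = 0
    · simp [hu]
    by_cases hv : v = 0
    · simp [hv]
    have hu' := norm_ne_zero_iff.2 hu
    have hv' := norm_ne_zero_iff.2 hv
    rw [inner_smul_left, inner_smul_right, norm_mul, norm_mul, hunit u v hu hv, inner_smul_left,
      inner_smul_right, norm_mul, norm_mul]
    simp only [RCLike.norm_conj, norm_inv, Complex.norm_real, norm_norm]
    field_simp
  obtain ⟨U, hadd, hlin, hphase⟩ := exists_semilinear_isometry (E := H) (F := H)
    (T := fun x => ((‖x‖ : ℝ) : ℂ) • τ x) hT he
  have hnorm : ∀ x, ‖U x‖ = ‖x‖ := by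
    intro x
    obtain ⟨c, hc, hx⟩ := hphase x
    rw [hx, norm_smul, norm_smul, hc, hτn]
    simp
  refine ⟨U, hadd, hnorm, ?_, hlin, ?_⟩
  · have hreal : ∀ (r : ℝ) x, U (r • x) = r • U x := by
      intro r x
      rw [← Complex.coe_smul r x, ← Complex.coe_smul r (U x)]
      rcases hlin with h | h
      · rw [h]
      · rw [h, Complex.conj_ofReal]
    let V : H →ₗ[ℝ] H := { toFun := U, map_add' := hadd, map_smul' := hreal }
    have : FiniteDimensional ℝ H := FiniteDimensional.complexToReal H
    have hV : Function.Injective V := (injective_iff_map_eq_zero V).2 fun x hx => by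
      rw [← norm_eq_zero, ← hnorm x]
      exact norm_eq_zero.2 hx
    exact LinearMap.injective_iff_surjective.1 hV
  · intro v hv P hP
    obtain ⟨c, hc, hx⟩ := hphase v
    rw [hx, rankOneProj_phase_smul hc, hv, Complex.ofReal_one, one_smul]
    refine hτ v P ?_
    rw [hP, hv]
    simp
end

section
/- Let φ: P(H) → P(H) satisfy ‖φ(P) − φ(Q)‖ ≤ ‖P − Q‖ for all P, Q ∈ P(H), let n be a positive integer, and let {P_1, …, P_n} ⊆ P(H) be an OSP contained in the image of φ. If Q_1, …, Q_n ∈ P(H) satisfy φ(Q_j) = P_j for j = 1, …, n, then {Q_1, …, Q_n} is also an OSP. -/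
open scoped InnerProductSpace ComplexConjugate

variable {H : Type*} [NormedAddCommGroup H] [InnerProductSpace ℂ H] [CompleteSpace H]

/-- A rank-one projection is `x ↦ ⟪u, x⟫ u` for some unit vector `u`. -/
theorem IsRankOneProjection.exists_unit_vector {P : H →L[ℂ] H} (hP : IsRankOneProjection P) :
    ∃ u : H, ‖u‖ = 1 ∧ ∀ x, P x = ⟪u, x⟫_ℂ • u := by
  obtain ⟨hsa, hidem, hrank⟩ := hP
  obtain ⟨⟨w, y, rfl⟩, hw, hspan⟩ := finrank_eq_one_iff'.mp hrank
  have hw0 : P y ≠ 0 := fun h => hw (Subtype.ext h)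
  have hn : (‖P y‖ : ℂ) ≠ 0 := by simpa using hw0
  set u : H := (‖P y‖ : ℂ)⁻¹ • P y with hu
  have hu1 : ‖u‖ = 1 := by
    rw [hu, norm_smul, norm_inv, Complex.norm_real, norm_norm,
      inv_mul_cancel₀ (norm_ne_zero_iff.mpr hw0)]
  have hPu : P u = u := by
    rw [hu, map_smul, ← ContinuousLinearMap.comp_apply, hidem]
  refine ⟨u, hu1, fun x => ?_⟩
  obtain ⟨c, hc⟩ := hspan ⟨P x, x, rfl⟩
  have hc' : P x = (c * ‖P y‖) • u := by
    rw [hu, smul_smul, mul_assoc, mul_inv_cancel₀ hn, mul_one]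
    exact (congrArg Subtype.val hc).symm
  have hin : ⟪u, x⟫_ℂ = ⟪u, P x⟫_ℂ := by
    have h := hsa.isSymmetric u x
    simp only [ContinuousLinearMap.coe_coe, hPu] at h
    exact h
  rw [hin, hc', inner_smul_right, inner_self_eq_norm_sq_to_K, hu1]
  simp

/-- Orthogonal rank-one projections are at distance at least one. -/
theorem IsRankOneProjection.one_le_norm_sub_of_comp_eq_zero {P Q : H →L[ℂ] H}
    (hP : IsRankOneProjection P) (h : Q ∘L P = 0) : 1 ≤ ‖P - Q‖ := by
  obtain ⟨u, hu, hPx⟩ := hP.exists_unit_vector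
  have hPu : P u = u := by
    rw [hPx, inner_self_eq_norm_sq_to_K, hu]
    simp
  have hQu : Q u = 0 := by
    rw [← hPu, ← ContinuousLinearMap.comp_apply, h]
    simp
  have := (P - Q).le_opNorm u
  simpa [hPu, hQu, hu] using this

/-- Rank-one projections at distance at least one are orthogonal. -/
theorem IsRankOneProjection.comp_eq_zero_of_one_le_norm_sub {P Q : H →L[ℂ] H}
    (hP : IsRankOneProjection P) (hQ : IsRankOneProjection Q) (h : 1 ≤ ‖P - Q‖) :
    P ∘L Q = 0 := by
  have hsa : IsSelfAdjoint (P - Q) := hP.1.sub hQ.1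
  obtain ⟨u, hu, hPx⟩ := hP.exists_unit_vector
  obtain ⟨v, hv, hQx⟩ := hQ.exists_unit_vector
  have huu : ⟪u, u⟫_ℂ = 1 := by simp [inner_self_eq_norm_sq_to_K, hu]
  have hvv : ⟪v, v⟫_ℂ = 1 := by simp [inner_self_eq_norm_sq_to_K, hv]
  have huv : ⟪u, v⟫_ℂ * ⟪v, u⟫_ℂ = ((‖⟪u, v⟫_ℂ‖ ^ 2 : ℝ) : ℂ) := by
    rw [← inner_conj_symm v u, Complex.mul_conj, Complex.normSq_eq_norm_sq]
  set D := P - Q with hD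
  have hcube : D * D * D = ((1 - ‖⟪u, v⟫_ℂ‖ ^ 2 : ℝ) : ℂ) • D := by
    ext x
    rw [Complex.ofReal_sub, ← huv]
    simp only [hD, mul_apply_eq_comp, sub_apply,
      smul_apply, hPx, hQx, inner_sub_right, inner_smul_right, huu, hvv,
      Complex.ofReal_one]
    module
  have hnorm : ∀ T : H →L[ℂ] H, IsSelfAdjoint T → ‖T * T‖ = ‖T‖ * ‖T‖ := fun T hT => by
    simpa [hT.star_eq] using CStarRing.norm_star_mul_self (x := T)
  have hle : ‖⟪u, v⟫_ℂ‖ ≤ 1 := by simpa [hu, hv] using norm_inner_le_norm (𝕜 := ℂ) u v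
  have hpow : ‖D‖ ^ 4 = (1 - ‖⟪u, v⟫_ℂ‖ ^ 2) * ‖D‖ ^ 2 := by
    have h4 := hnorm (D * D) (by simp [IsSelfAdjoint, hsa.star_eq])
    rw [← mul_assoc, hcube, smul_mul_assoc, norm_smul, hnorm D hsa, Complex.norm_real,
      Real.norm_of_nonneg (by nlinarith [norm_nonneg ⟪u, v⟫_ℂ])] at h4
    linarith
  have hzero : ⟪u, v⟫_ℂ = 0 := by
    have h2 : 1 ≤ ‖D‖ ^ 2 := one_le_pow₀ h
    have : ‖⟪u, v⟫_ℂ‖ ^ 2 = 0 := by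
      nlinarith [sq_nonneg ‖⟪u, v⟫_ℂ‖]
    simpa using this
  ext x
  simp [hPx, hQx, hzero]

/-- first part of Lemma 2.3. If `φ` is nonexpansive on the set of rank-one
projections, `{P_1, …, P_n}` is an orthogonal system of rank-one projections contained in the
image of `φ`, and `φ (Q j) = P j` for all `j`, then `{Q_1, …, Q_n}` is also an orthogonal
system of rank-one projections. -/
theorem preimage_of_OSP_is_OSP
    (φ : {P : H →L[ℂ] H // IsRankOneProjection P} → {P : H →L[ℂ] H // IsRankOneProjection P})
    (hne : ∀ P Q : {P : H →L[ℂ] H // IsRankOneProjection P},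
      ‖(φ P).1 - (φ Q).1‖ ≤ ‖P.1 - Q.1‖)
    (n : ℕ) (hn : 0 < n)
    (P Q : Fin n → {P : H →L[ℂ] H // IsRankOneProjection P})
    (hOSP : ∀ i j, i ≠ j → (P i).1 ∘L (P j).1 = 0)
    (hpre : ∀ j, φ (Q j) = P j) :
    ∀ i j, i ≠ j → (Q i).1 ∘L (Q j).1 = 0 := by
  intro i j hij
  refine (Q i).2.comp_eq_zero_of_one_le_norm_sub (Q j).2 ?_
  calc 1 ≤ ‖(P i).1 - (P j).1‖ :=
        (P i).2.one_le_norm_sub_of_comp_eq_zero (hOSP j i hij.symm)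
    _ = ‖(φ (Q i)).1 - (φ (Q j)).1‖ := by rw [hpre, hpre]
    _ ≤ ‖(Q i).1 - (Q j).1‖ := hne _ _
end

section
/- Let g: S¹ → S¹ be a nonexpansive map of the unit circle. Then one of the following holds: (i) there is c ∈ S¹ such that g(z) = cz for all z ∈ S¹; (ii) there is c ∈ S¹ such that g(z) = c·conj(z) for all z ∈ S¹; (iii) the image g(S¹) ⊆ S¹ is compact, connected, and contained in some closed half-circle (an arc of S¹ of angular length π). -/
open scoped Real

namespace Circle

lemma re_sq_add_im_sq (z : Circle) : (z : ℂ).re ^ 2 + (z : ℂ).im ^ 2 = 1 := by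
  have h := z.normSq_coe
  rw [Complex.normSq_apply] at h
  linarith

lemma norm_sub_sq (z w : Circle) :
    ‖(z : ℂ) - w‖ ^ 2 = 2 - 2 * ((z : ℂ).re * (w : ℂ).re + (z : ℂ).im * (w : ℂ).im) := by
  rw [← Complex.normSq_eq_norm_sq, Complex.normSq_apply, Complex.sub_re, Complex.sub_im]
  linarith [re_sq_add_im_sq z, re_sq_add_im_sq w]

lemma norm_sub_le_norm_sub_iff {z w z' w' : Circle} :
    ‖(z : ℂ) - w‖ ≤ ‖(z' : ℂ) - w'‖ ↔
      (z' : ℂ).re * (w' : ℂ).re + (z' : ℂ).im * (w' : ℂ).im ≤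
        (z : ℂ).re * (w : ℂ).re + (z : ℂ).im * (w : ℂ).im := by
  rw [← sq_le_sq₀ (norm_nonneg _) (norm_nonneg _), norm_sub_sq, norm_sub_sq]
  constructor <;> intro h <;> linarith

lemma eq_neg_of_norm_sub_eq {z w z' w' : Circle} (h : (z : ℂ) = -w)
    (hle : ‖(z : ℂ) - w‖ ≤ ‖(z' : ℂ) - w'‖) : (z' : ℂ) = -w' := by
  rw [norm_sub_le_norm_sub_iff, h, Complex.neg_re, Complex.neg_im] at hle
  have h0 : ((z' : ℂ).re + (w' : ℂ).re) ^ 2 + ((z' : ℂ).im + (w' : ℂ).im) ^ 2 ≤ 0 := by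
    nlinarith [re_sq_add_im_sq w, re_sq_add_im_sq z', re_sq_add_im_sq w']
  have h1 : (z' : ℂ).re + (w' : ℂ).re = 0 := by nlinarith
  have h2 : (z' : ℂ).im + (w' : ℂ).im = 0 := by nlinarith
  apply Complex.ext
  · rw [Complex.neg_re]; linarith
  · rw [Complex.neg_im]; linarith

/-- A nonexpansive self-map of the circle fixing `1` and `-1` is the identity, the conjugation,
or has its image in one of the half-circles bounded by `1` and `-1`. -/
lemma nonexpansive_fixing_one_neg_one {h : Circle → Circle}
    (hne : ∀ z w : Circle, ‖(h z : ℂ) - h w‖ ≤ ‖(z : ℂ) - w‖)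
    (h_one : h 1 = 1) (h_neg : h (-1) = -1) :
    (∀ z, (h z : ℂ) = z) ∨ (∀ z, (h z : ℂ) = (starRingEnd ℂ) z) ∨
      (∀ z, 0 ≤ (h z : ℂ).im) ∨ (∀ z, (h z : ℂ).im ≤ 0) := by
  have key := fun z w => norm_sub_le_norm_sub_iff.1 (hne z w)
  have hre : ∀ z, (h z : ℂ).re = (z : ℂ).re := by
    intro z
    have h1 := key z 1
    have h2 := key z (-1)
    rw [h_one] at h1
    rw [h_neg] at h2
    simp at h1 h2
    linarith
  have him : ∀ z, (h z : ℂ).im = (z : ℂ).im ∨ (h z : ℂ).im = -(z : ℂ).im := by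
    intro z
    apply sq_eq_sq_iff_eq_or_eq_neg.1
    have h1 := re_sq_add_im_sq z
    have h2 := re_sq_add_im_sq (h z)
    rw [hre] at h2
    linarith
  obtain ⟨i, hi⟩ : ∃ i : Circle, (i : ℂ) = Complex.I :=
    ⟨⟨Complex.I, by simp [Submonoid.unitSphere]⟩, rfl⟩
  have hI := him i
  have hI_neg := him (-i)
  have kI := fun z => key z i
  have kI_neg := fun z => key z (-i)
  have rI := hre i
  have rI_neg := hre (-i)
  simp only [hi, Circle.coe_neg, Complex.neg_re, Complex.neg_im, Complex.I_re,
    Complex.I_im, neg_zero, neg_neg] at hI hI_neg kI kI_neg rI rI_neg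
  simp only [rI, rI_neg] at kI kI_neg
  rcases hI with hI | hI <;> rcases hI_neg with hI_neg | hI_neg <;> simp only [hI, hI_neg] at kI kI_neg
  · refine Or.inl fun z => Complex.ext (hre z) ?_
    linarith [kI z, kI_neg z]
  · refine Or.inr (Or.inr (Or.inl fun z => ?_))
    linarith [kI z, kI_neg z]
  · refine Or.inr (Or.inr (Or.inr fun z => ?_))
    linarith [kI z, kI_neg z]
  · refine Or.inr (Or.inl fun z => Complex.ext ?_ ?_)
    · rw [Complex.conj_re, hre]
    · rw [Complex.conj_im]
      linarith [kI z, kI_neg z]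

/-- A continuous map from a compact connected space to the circle whose image contains no pair of
antipodal points has image in a closed half-circle. -/
lemma exists_half_circle_of_ne_neg {X : Type*} [TopologicalSpace X] [CompactSpace X]
    [ConnectedSpace X] {f : X → Circle} (hf : Continuous f)
    (hanti : ∀ x y, (f x : ℂ) ≠ -f y) :
    ∃ c : Circle, ∀ x, ∃ θ : ℝ, 0 ≤ θ ∧ θ ≤ π ∧ (f x : ℂ) = Complex.exp (θ * Complex.I) * c := by
  obtain ⟨x₀⟩ : Nonempty X := inferInstance
  have hslit : ∀ x, ((f x / f x₀ : Circle) : ℂ) ∈ Complex.slitPlane := by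
    intro x
    by_contra hx
    rw [Complex.mem_slitPlane_iff, not_or, not_lt, not_not] at hx
    have h1 := re_sq_add_im_sq (f x / f x₀)
    rw [hx.2] at h1
    have h2 : ((f x / f x₀ : Circle) : ℂ).re = -1 := by nlinarith
    have h3 : ((f x / f x₀ : Circle) : ℂ) = -1 :=
      Complex.ext (by simpa using h2) (by simpa using hx.2)
    rw [Circle.coe_div, div_eq_iff (Circle.coe_ne_zero _), neg_one_mul] at h3
    exact hanti _ _ h3
  set φ : X → ℝ := fun x => Complex.arg ((f x / f x₀ : Circle) : ℂ) with hφ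
  have hφc : Continuous φ := by
    rw [continuous_iff_continuousAt]
    intro x
    have hc : Continuous fun x => ((f x / f x₀ : Circle) : ℂ) := by fun_prop
    exact ContinuousAt.comp (f := fun x => ((f x / f x₀ : Circle) : ℂ))
      (Complex.continuousAt_arg (hslit x)) hc.continuousAt
  have hexp : ∀ x, (f x : ℂ) = Complex.exp (φ x * Complex.I) * f x₀ := by
    intro x
    have h1 := Complex.norm_mul_exp_arg_mul_I ((f x / f x₀ : Circle) : ℂ)
    rw [Circle.norm_coe, Complex.ofReal_one, one_mul] at h1
    rw [hφ, h1, Circle.coe_div, div_mul_cancel₀ _ (Circle.coe_ne_zero _)]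
  obtain ⟨a, -, ha⟩ := isCompact_univ.exists_isMinOn Set.univ_nonempty hφc.continuousOn
  have ha' : ∀ x, φ a ≤ φ x := fun x => ha (Set.mem_univ x)
  have hle : ∀ x, φ x ≤ φ a + π := by
    intro x
    by_contra! hx
    obtain ⟨y, hy⟩ := mem_range_of_exists_le_of_exists_ge hφc
      ⟨a, le_add_of_nonneg_right Real.pi_pos.le⟩ ⟨x, hx.le⟩
    apply hanti y a
    rw [hexp y, hexp a, hy, Complex.ofReal_add, add_mul, Complex.exp_add, Complex.exp_pi_mul_I]
    ring
  refine ⟨f a, fun x => ⟨φ x - φ a, by linarith [ha' x], by linarith [hle x], ?_⟩⟩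
  rw [hexp a, hexp x, ← mul_assoc, ← Complex.exp_add]
  push_cast
  ring_nf

lemma exists_exp_of_im_nonneg {z : Circle} (hz : 0 ≤ (z : ℂ).im) :
    ∃ θ : ℝ, 0 ≤ θ ∧ θ ≤ π ∧ (z : ℂ) = Complex.exp (θ * Complex.I) := by
  refine ⟨Complex.arg z, Complex.arg_nonneg_iff.2 hz, Complex.arg_le_pi _, ?_⟩
  have h := Complex.norm_mul_exp_arg_mul_I (z : ℂ)
  rw [Circle.norm_coe, Complex.ofReal_one, one_mul] at h
  exact h.symm

end Circle

/-- Lemma 2.5. Let `g : S¹ → S¹` be nonexpansive. Then either `g` is a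
rotation `z ↦ c·z`, or a reflection `z ↦ c·conj z`, or its image is compact, connected and
contained in a closed half-circle. -/
theorem nonexpansive_circle_map_trichotomy
    (g : Circle → Circle)
    (hne : ∀ z w : Circle, ‖(g z : ℂ) - (g w : ℂ)‖ ≤ ‖(z : ℂ) - (w : ℂ)‖) :
    (∃ c : Circle, ∀ z : Circle, g z = c * z) ∨
    (∃ c : Circle, ∀ z : Circle, (g z : ℂ) = (c : ℂ) * (starRingEnd ℂ) (z : ℂ)) ∨
    (IsCompact (Set.range fun z : Circle => (g z : ℂ)) ∧
      IsConnected (Set.range fun z : Circle => (g z : ℂ)) ∧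
      ∃ c : Circle, (Set.range fun z : Circle => (g z : ℂ)) ⊆
        {w : ℂ | ∃ θ : ℝ, 0 ≤ θ ∧ θ ≤ π ∧ w = Complex.exp (θ * Complex.I) * (c : ℂ)}) := by
  have hg : Continuous g := by
    refine (LipschitzWith.of_dist_le_mul (K := 1) fun z w => ?_).continuous
    change dist (g z : ℂ) (g w) ≤ 1 * dist (z : ℂ) w
    rw [one_mul, dist_eq_norm, dist_eq_norm]
    exact hne z w
  have hgc : Continuous fun z : Circle => (g z : ℂ) := by fun_prop
  have : ConnectedSpace Circle := by
    refine connectedSpace_iff_univ.2 ?_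
    have h : Function.Surjective Circle.exp := fun z => ⟨_, Circle.exp_arg z⟩
    rw [← h.range_eq]
    exact isConnected_range Circle.exp.continuous
  have reduce : (∃ c : Circle, ∀ z, ∃ θ : ℝ, 0 ≤ θ ∧ θ ≤ π ∧
      (g z : ℂ) = Complex.exp (θ * Complex.I) * c) →
      (IsCompact (Set.range fun z : Circle => (g z : ℂ)) ∧
      IsConnected (Set.range fun z : Circle => (g z : ℂ)) ∧
      ∃ c : Circle, (Set.range fun z : Circle => (g z : ℂ)) ⊆
        {w : ℂ | ∃ θ : ℝ, 0 ≤ θ ∧ θ ≤ π ∧ w = Complex.exp (θ * Complex.I) * (c : ℂ)}) := by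
    rintro ⟨c, hc⟩
    exact ⟨isCompact_range hgc, isConnected_range hgc, c, Set.range_subset_iff.2 hc⟩
  by_cases hanti : ∀ x y, (g x : ℂ) ≠ -g y
  · exact Or.inr (Or.inr (reduce (Circle.exists_half_circle_of_ne_neg hg hanti)))
  push Not at hanti
  obtain ⟨b, a, hab⟩ := hanti
  have hb : b = -a := Circle.ext (by simpa using Circle.eq_neg_of_norm_sub_eq hab (hne b a))
  have hga : g (-a) = -g a := Circle.ext (by simpa [hb] using hab)
  set h : Circle → Circle := fun z => (g a)⁻¹ * g (a * z) with hh
  have hgh : ∀ z, (g z : ℂ) = h (a⁻¹ * z) * g a := by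
    intro z
    rw [← Circle.coe_mul]
    simp [hh, mul_comm]
  have hne' : ∀ z w : Circle, ‖(h z : ℂ) - h w‖ ≤ ‖(z : ℂ) - w‖ := by
    intro z w
    have h1 := hne (a * z) (a * w)
    simp only [Circle.coe_mul, ← mul_sub, norm_mul, Circle.norm_coe, one_mul] at h1
    simpa only [hh, Circle.coe_mul, ← mul_sub, norm_mul, Circle.norm_coe, one_mul] using h1
  rcases Circle.nonexpansive_fixing_one_neg_one hne' (by simp [hh]) (by simp [hh, hga]) with
    h1 | h1 | h1 | h1
  · refine Or.inl ⟨g a * a⁻¹, fun z => Circle.ext ?_⟩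
    rw [hgh, h1]
    push_cast
    ring
  · refine Or.inr (Or.inl ⟨g a * a, fun z => ?_⟩)
    rw [hgh, h1, ← Circle.coe_inv_eq_conj, ← Circle.coe_inv_eq_conj]
    push_cast
    rw [mul_inv, inv_inv]
    ring
  · refine Or.inr (Or.inr (reduce ⟨g a, fun z => ?_⟩))
    obtain ⟨θ, h0, hπ, hθ⟩ := Circle.exists_exp_of_im_nonneg (h1 (a⁻¹ * z))
    exact ⟨θ, h0, hπ, by rw [hgh, hθ]⟩
  · refine Or.inr (Or.inr (reduce ⟨-g a, fun z => ?_⟩))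
    obtain ⟨θ, h0, hπ, hθ⟩ := Circle.exists_exp_of_im_nonneg (z := -h (a⁻¹ * z))
      (by simpa using h1 (a⁻¹ * z))
    exact ⟨θ, h0, hπ, by rw [hgh, ← hθ]; simp⟩
end
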